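/- Let L be a smooth k-th order Lagrangian. If a smooth function φ : ℝ^n → ℝ together with smooth momenta p^{μ₁…μ_l λ} (symmetric in μ₁…μ_l) satisfies the canonical first-order Euler–Lagrange system of L, then there exist smooth momenta s^{μ₁…μ_l λ} that are totally symmetric in all their indices (s^{μ₁…μ_l λ} = s^{(μ₁…μ_l λ)} for every 0 ≤ l ≤ k−1) such that the pair (φ, s) also satisfies the canonical first-order Euler–Lagrange system of L. -/

import Mathlib

noncomputable section

open scoped BigOperators

/-- Points of the base `ℝⁿ`. -/
abbrev Vec (n : ℕ) : Type := Fin n → ℝ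

/-- The space of jet variables `(u_{μ₁…μ_r})_{0 ≤ r ≤ k}` of order `≤ k`
(arrays indexed by tuples of indices). -/
abbrev JetU (n k : ℕ) : Type := ∀ r : Fin (k + 1), (Fin (r : ℕ) → Fin n) → ℝ

/-- The full variable space `(x^μ; u_{μ₁…μ_r}, 0 ≤ r ≤ k)` of a `k`-th order
Lagrangian. -/
abbrev Jet (n k : ℕ) : Type := Vec n × JetU n k

/-- Iterated partial derivative `∂_{t 0} ⋯ ∂_{t (l-1)} g` at `x`. -/
def pderivIter (n l : ℕ) (t : Fin l → Fin n) (g : Vec n → ℝ) (x : Vec n) : ℝ :=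
  iteratedFDeriv ℝ l g x fun i => Pi.single (t i) 1

/-- Partial derivative `∂_λ g` at `x`. -/
def pderiv1 (n : ℕ) (lam : Fin n) (g : Vec n → ℝ) (x : Vec n) : ℝ :=
  fderiv ℝ g x (Pi.single lam 1)

/-- The `k`-jet of `φ` at `x`: substitute `u_{μ₁…μ_r} = ∂_{μ₁}⋯∂_{μ_r} φ(x)`. -/
def jetEv (n k : ℕ) (φ : Vec n → ℝ) (x : Vec n) : Jet n k :=
  (x, fun r t => pderivIter n (r : ℕ) t φ x)

/-- The symmetric array `∂L/∂u_{μ₁…μ_r}` (the array characterized by the fact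
that its full contraction with a symmetric increment of the rank-`r` jet
variables is the corresponding directional derivative of `L`), evaluated at the
tuple `t` and the point `z`. -/
def dLdu (n k : ℕ) (L : Jet n k → ℝ) (r : Fin (k + 1)) (t : Fin (r : ℕ) → Fin n)
    (z : Jet n k) : ℝ :=
  ((r : ℕ).factorial : ℝ)⁻¹ *
    ∑ σ : Equiv.Perm (Fin (r : ℕ)),
      fderiv ℝ L z (0, Pi.single r (Pi.single (t ∘ σ) 1))

/-- Total symmetrization `q^{(μ₁…μ_l λ)}` of a momentum array
`q^{μ₁…μ_l λ}`, evaluated at the length-`(l+1)` tuple `s`. -/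
def symComb (n l : ℕ) (q : (Fin l → Fin n) → Fin n → ℝ) (s : Fin (l + 1) → Fin n) : ℝ :=
  ((l + 1).factorial : ℝ)⁻¹ *
    ∑ σ : Equiv.Perm (Fin (l + 1)),
      q (fun i => s (σ (Fin.castSucc i))) (s (σ (Fin.last l)))

/-- Momenta `p^{μ₁…μ_l λ}` (`0 ≤ l ≤ k−1`) for a `k`-th order theory:
fields on `ℝⁿ` indexed by a tuple `μ₁…μ_l` and an extra index `λ`. -/
abbrev Mom (n k : ℕ) : Type := ∀ l : Fin k, (Fin (l : ℕ) → Fin n) → Fin n → Vec n → ℝ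

/-- `C^∞` smoothness. -/
def IsCInf {E F : Type*} [NormedAddCommGroup E] [NormedSpace ℝ E]
    [NormedAddCommGroup F] [NormedSpace ℝ F] (f : E → F) : Prop :=
  ∀ m : ℕ, ContDiff ℝ m f

/-- All components of the momenta are smooth. -/
def MomSmooth (n k : ℕ) (p : Mom n k) : Prop :=
  ∀ (l : Fin k) (t : Fin (l : ℕ) → Fin n) (lam : Fin n), IsCInf (p l t lam)

/-- The momenta are symmetric in the indices `μ₁…μ_l`. -/
def MomSym (n k : ℕ) (p : Mom n k) : Prop :=
  ∀ (l : Fin k) (σ : Equiv.Perm (Fin (l : ℕ))) (t : Fin (l : ℕ) → Fin n)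
    (lam : Fin n) (x : Vec n), p l (t ∘ σ) lam x = p l t lam x

/-- The momenta are totally symmetric in all indices `μ₁…μ_l λ`. -/
def MomTotSym (n k : ℕ) (p : Mom n k) : Prop :=
  ∀ (l : Fin k) (σ : Equiv.Perm (Fin ((l : ℕ) + 1))) (s : Fin ((l : ℕ) + 1) → Fin n)
    (x : Vec n),
    p l (fun i => s (σ (Fin.castSucc i))) (s (σ (Fin.last (l : ℕ)))) x
      = p l (fun i => s (Fin.castSucc i)) (s (Fin.last (l : ℕ))) x

/-- The canonical first-order Euler–Lagrange system of a `(K+1)`-th order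
Lagrangian `L` for a pair `(φ, p)`:
`p^{(μ₁…μ_k)} = ∂L/∂u_{μ₁…μ_k}`;
`p^{(μ₁…μ_l)} = ∂L/∂u_{μ₁…μ_l} − Σ_λ ∂_λ p^{μ₁…μ_l λ}` for `1 ≤ l ≤ k−1`;
`0 = ∂L/∂u − Σ_λ ∂_λ p^λ`, all derivatives of `L` being evaluated along the
`k`-jet of `φ` (here `k = K+1`). -/
def CanonSys (n K : ℕ) (L : Jet n (K + 1) → ℝ) (φ : Vec n → ℝ) (p : Mom n (K + 1)) : Prop :=
  (∀ x : Vec n,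
      dLdu n (K + 1) L ⟨0, Nat.succ_pos _⟩ Fin.elim0 (jetEv n (K + 1) φ x)
        - ∑ lam : Fin n, pderiv1 n lam (p ⟨0, Nat.succ_pos _⟩ Fin.elim0 lam) x = 0)
  ∧ (∀ (l : Fin (K + 1)) (s : Fin ((l : ℕ) + 1) → Fin n) (x : Vec n),
      symComb n (l : ℕ) (fun t lam => p l t lam x) s
        = dLdu n (K + 1) L ⟨(l : ℕ) + 1, Nat.succ_lt_succ l.isLt⟩ s (jetEv n (K + 1) φ x)
          - if h : (l : ℕ) + 1 < K + 1 then
              ∑ lam : Fin n, pderiv1 n lam (p ⟨(l : ℕ) + 1, h⟩ s lam) x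
            else 0)

/-- The Euler–Lagrange equation of order `2k` (`k = K+1`) of `L` for `φ`:
`Σ_{r=0}^{k} (−1)^r Σ_{μ₁…μ_r} ∂_{μ₁}⋯∂_{μ_r}[∂L/∂u_{μ₁…μ_r} ∘ (k-jet of φ)] = 0`. -/
def ELeq (n K : ℕ) (L : Jet n (K + 1) → ℝ) (φ : Vec n → ℝ) : Prop :=
  ∀ x : Vec n,
    ∑ r : Fin (K + 2),
      ((-1 : ℝ) ^ (r : ℕ)) *
        ∑ t : Fin (r : ℕ) → Fin n,
          pderivIter n (r : ℕ) t
            (fun y => dLdu n (K + 1) L r t (jetEv n (K + 1) φ y)) x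
      = 0

open scoped ContDiff

section TensorDivergence

variable {ι M : Type*} [AddCommGroup M] [Module ℝ M]

/-- Symmetrization of a tensor with components in a real vector space. -/
def tensorSymm {l : ℕ} (T : (Fin l → ι) → M) (s : Fin l → ι) : M :=
  (l.factorial : ℝ)⁻¹ • ∑ σ : Equiv.Perm (Fin l), T (s ∘ σ)

lemma tensorSymm_comp_perm {l : ℕ} (T : (Fin l → ι) → M) (τ : Equiv.Perm (Fin l))
    (s : Fin l → ι) : tensorSymm T (s ∘ τ) = tensorSymm T s := by
  unfold tensorSymm
  congr 1
  exact Fintype.sum_equiv (Equiv.mulLeft τ) _ _ fun σ => rfl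

lemma tensorSymm_eq_self {l : ℕ} {T : (Fin l → ι) → M}
    (hT : ∀ (τ : Equiv.Perm (Fin l)) s, T (s ∘ τ) = T s) (s : Fin l → ι) :
    tensorSymm T s = T s := by
  have h : (l.factorial : ℝ) ≠ 0 := by positivity
  simp [tensorSymm, hT, Finset.card_univ, Fintype.card_perm, ← Nat.cast_smul_eq_nsmul ℝ,
    smul_smul, inv_mul_cancel₀ h]

variable [Fintype ι] (D : ι → Module.End ℝ M)

/-- Divergence of a tensor in its last index. -/
def tensorDiv {l : ℕ} (T : (Fin (l + 1) → ι) → M) (s : Fin l → ι) : M :=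
  ∑ i, D i (T (Fin.snoc s i))

/-- Divergence of a tensor in all of its indices. -/
def fullDiv {l : ℕ} (T : (Fin l → ι) → M) : M :=
  ∑ s, (List.ofFn fun i => D (s i)).prod (T s)

lemma fullDiv_sub {l : ℕ} (T U : (Fin l → ι) → M) :
    fullDiv D (fun s => T s - U s) = fullDiv D T - fullDiv D U := by
  simp [fullDiv]

lemma fullDiv_eq_fullDiv_tensorDiv {l : ℕ} (T : (Fin (l + 1) → ι) → M) :
    fullDiv D T = fullDiv D (tensorDiv D T) := by
  simp only [fullDiv, tensorDiv, map_sum]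
  rw [← Equiv.sum_comp (Fin.snocEquiv fun _ => ι), Fintype.sum_prod_type, Finset.sum_comm]
  refine Finset.sum_congr rfl fun s _ => Finset.sum_congr rfl fun i _ => ?_
  rw [List.ofFn_succ']
  simp [List.concat_eq_append, Fin.snocEquiv]

lemma tensorDiv_comp_perm {l : ℕ} {T : (Fin (l + 1) → ι) → M}
    (hT : ∀ (τ : Equiv.Perm (Fin (l + 1))) s, T (s ∘ τ) = T s)
    (τ : Equiv.Perm (Fin l)) (s : Fin l → ι) :
    tensorDiv D T (s ∘ τ) = tensorDiv D T s := by
  refine Finset.sum_congr rfl fun i _ => ?_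
  rw [← hT ((finSuccEquivLast.trans (Equiv.optionCongr τ)).trans finSuccEquivLast.symm)
    (Fin.snoc s i)]
  congr 2
  funext j
  refine Fin.lastCases ?_ (fun j => ?_) j <;> simp

variable {D}

lemma fullDiv_comp_perm (hD : ∀ i j, Commute (D i) (D j)) {l : ℕ} (T : (Fin l → ι) → M)
    (τ : Equiv.Perm (Fin l)) : fullDiv D (fun s => T (s ∘ τ)) = fullDiv D T := by
  refine Fintype.sum_equiv (Equiv.arrowCongr τ.symm (Equiv.refl ι)) _ _ fun s => ?_
  have hperm := Equiv.Perm.ofFn_comp_perm τ (fun i => D (s i))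
  have : (List.ofFn ((fun i => D (s i)) ∘ τ)).prod = (List.ofFn fun i => D (s i)).prod := by
    refine hperm.prod_eq' ?_
    rw [List.pairwise_ofFn]
    exact fun i j _ => hD _ _
  rw [← this]
  rfl

lemma fullDiv_tensorSymm (hD : ∀ i j, Commute (D i) (D j)) {l : ℕ} (T : (Fin l → ι) → M) :
    fullDiv D (tensorSymm T) = fullDiv D T := by
  have h : (l.factorial : ℝ) ≠ 0 := by positivity
  have hsum : fullDiv D (tensorSymm T) =
      (l.factorial : ℝ)⁻¹ • ∑ σ : Equiv.Perm (Fin l), fullDiv D (fun s => T (s ∘ σ)) := by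
    simp only [fullDiv, tensorSymm, map_smul, map_sum]
    rw [← Finset.smul_sum, Finset.sum_comm]
  rw [hsum]
  simp [fullDiv_comp_perm hD, Finset.card_univ, Fintype.card_perm, ← Nat.cast_smul_eq_nsmul ℝ,
    smul_smul, inv_mul_cancel₀ h]

variable (D)

/-- The alternating sum `F l - div F (l + 1) + div div F (l + 2) - ⋯` with `j` terms. -/
def divTail (F : ∀ l : ℕ, (Fin l → ι) → M) : ℕ → ∀ l : ℕ, (Fin l → ι) → M
  | 0, _, _ => 0
  | j + 1, l, s => F l s - tensorDiv D (divTail F j (l + 1)) s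

lemma divTail_comp_perm {F : ∀ l : ℕ, (Fin l → ι) → M}
    (hF : ∀ l (τ : Equiv.Perm (Fin l)) s, F l (s ∘ τ) = F l s) (j l : ℕ)
    (τ : Equiv.Perm (Fin l)) (s : Fin l → ι) :
    divTail D F j l (s ∘ τ) = divTail D F j l s := by
  induction j generalizing l with
  | zero => rfl
  | succ j ih =>
    simp only [divTail]
    rw [hF, tensorDiv_comp_perm D (ih (l + 1))]

variable {D}

/-- If a tower of tensors `q` solves `q l ^ sym = F (l + 1) - div q (l + 1)`, `F 0 = div q 0`,
then the same system has a totally symmetric solution. -/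
lemma exists_symmetric_tower (hD : ∀ i j, Commute (D i) (D j)) (N : ℕ)
    (F : ∀ l : ℕ, (Fin l → ι) → M) (q : ∀ l : ℕ, (Fin (l + 1) → ι) → M)
    (hF : ∀ l (τ : Equiv.Perm (Fin l)) s, F l (s ∘ τ) = F l s)
    (hq : ∀ l, N ≤ l → q l = 0)
    (h0 : ∀ s, F 0 s = tensorDiv D (q 0) s)
    (hsucc : ∀ l < N, ∀ s, tensorSymm (q l) s = F (l + 1) s - tensorDiv D (q (l + 1)) s) :
    ∃ G : ∀ l : ℕ, (Fin l → ι) → M,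
      (∀ l (τ : Equiv.Perm (Fin l)) s, G l (s ∘ τ) = G l s) ∧
      (∀ l, N < l → G l = 0) ∧ G 0 = 0 ∧
      ∀ l ≤ N, ∀ s, G l s = F l s - tensorDiv D (G (l + 1)) s := by
  obtain ⟨G, hG⟩ : ∃ G : ∀ l : ℕ, (Fin l → ι) → M, ∀ l, G l = divTail D F (N + 1 - l) l :=
    ⟨_, fun _ => rfl⟩
  have hGtop : ∀ l, N < l → G l = 0 := fun l hl => by
    rw [hG, Nat.sub_eq_zero_of_le hl]
    rfl
  have hGrec : ∀ l ≤ N, ∀ s, G l s = F l s - tensorDiv D (G (l + 1)) s := fun l hl s => by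
    rw [hG, hG, show N + 1 - l = (N + 1 - (l + 1)) + 1 by omega]
    rfl
  have hfull : ∀ l ≤ N, fullDiv D (G l) = fullDiv D (F l) - fullDiv D (G (l + 1)) :=
    fun l hl => by
      rw [funext (hGrec l hl), fullDiv_sub, fullDiv_eq_fullDiv_tensorDiv D (G (l + 1))]
  have hGq : ∀ l ≤ N, fullDiv D (G (l + 1)) = fullDiv D (q l) := by
    intro l hl
    induction hl using Nat.decreasingInduction with
    | self =>
      rw [hGtop _ N.lt_succ_self, hq N le_rfl]
    | of_succ l hl ih =>
      rw [hfull _ hl, ih, ← fullDiv_tensorSymm hD (q l), funext (hsucc l hl), fullDiv_sub,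
        fullDiv_eq_fullDiv_tensorDiv D (q (l + 1))]
  refine ⟨G, fun l => ?_, hGtop, ?_, hGrec⟩
  · rw [hG]
    exact divTail_comp_perm D hF _ _
  · have hzero : fullDiv D (G 0) = 0 := by
      rw [hfull 0 N.zero_le, hGq 0 N.zero_le, funext h0, ← fullDiv_eq_fullDiv_tensorDiv, sub_self]
    funext s
    simpa [fullDiv, Subsingleton.elim s default] using hzero

end TensorDivergence

/-- The space of smooth functions on `ℝⁿ`. -/
def smoothFn (n : ℕ) : Submodule ℝ (Vec n → ℝ) where
  carrier := {f | ContDiff ℝ ∞ f}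
  add_mem' {f g} (hf : ContDiff ℝ ∞ f) (hg : ContDiff ℝ ∞ g) :=
    show ContDiff ℝ ∞ (f + g) from hf.add hg
  zero_mem' := show ContDiff ℝ ∞ (fun _ => 0) from contDiff_const
  smul_mem' c f (hf : ContDiff ℝ ∞ f) :=
    show ContDiff ℝ ∞ (c • f) from hf.const_smul c

lemma smoothFn.contDiff {n : ℕ} (f : smoothFn n) : ContDiff ℝ ∞ (f : Vec n → ℝ) := f.2

lemma contDiff_pderiv1 {n : ℕ} (i : Fin n) {f : Vec n → ℝ} (hf : ContDiff ℝ ∞ f) :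
    ContDiff ℝ ∞ (pderiv1 n i f) :=
  (hf.fderiv_right (m := ∞) (by simp)).clm_apply contDiff_const

/-- Partial derivatives as endomorphisms of the space of smooth functions. -/
def smoothPderiv (n : ℕ) (i : Fin n) : Module.End ℝ (smoothFn n) where
  toFun f := ⟨pderiv1 n i f, contDiff_pderiv1 i (smoothFn.contDiff f)⟩
  map_add' f g := by
    ext x
    have hf : DifferentiableAt ℝ (f : Vec n → ℝ) x := (smoothFn.contDiff f).differentiable (by simp) x
    have hg : DifferentiableAt ℝ (g : Vec n → ℝ) x := (smoothFn.contDiff g).differentiable (by simp) x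
    simp [pderiv1, fderiv_add hf hg]
  map_smul' c f := by
    ext x
    have hf : DifferentiableAt ℝ (f : Vec n → ℝ) x := (smoothFn.contDiff f).differentiable (by simp) x
    simp [pderiv1, fderiv_const_smul hf]

lemma commute_smoothPderiv (n : ℕ) (i j : Fin n) :
    Commute (smoothPderiv n i) (smoothPderiv n j) := by
  ext f x
  have hf : ContDiff ℝ ∞ (f : Vec n → ℝ) := smoothFn.contDiff f
  have hd : DifferentiableAt ℝ (fderiv ℝ (f : Vec n → ℝ)) x :=
    (hf.fderiv_right (m := ∞) (by simp)).differentiable (by simp) x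
  have hs : IsSymmSndFDerivAt ℝ (f : Vec n → ℝ) x :=
    hf.contDiffAt.isSymmSndFDerivAt (by simpa using ENat.LEInfty.out)
  have key : ∀ a b : Fin n, pderiv1 n a (pderiv1 n b f) x =
      fderiv ℝ (fderiv ℝ (f : Vec n → ℝ)) x (Pi.single a 1) (Pi.single b 1) := fun a b => by
    change fderiv ℝ (fun y => fderiv ℝ (f : Vec n → ℝ) y (Pi.single b 1)) x _ = _
    rw [fderiv_clm_apply hd (differentiableAt_const _)]
    simp
  change pderiv1 n i (pderiv1 n j f) x = pderiv1 n j (pderiv1 n i f) x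
  rw [key, key, hs.eq]

lemma contDiff_jetEv {n k : ℕ} {φ : Vec n → ℝ} (hφ : ContDiff ℝ ∞ φ) :
    ContDiff ℝ ∞ (jetEv n k φ) := by
  refine contDiff_id.prodMk (contDiff_pi.2 fun r => contDiff_pi.2 fun t => ?_)
  exact (ContinuousMultilinearMap.apply ℝ (fun _ : Fin (r : ℕ) => Vec n) ℝ
    fun i => Pi.single (t i) 1).contDiff.comp (hφ.iteratedFDeriv_right (m := ∞) (mod_cast le_top))

lemma contDiff_dLdu_jetEv {n k : ℕ} {L : Jet n k → ℝ} (hL : ContDiff ℝ ∞ L)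
    {φ : Vec n → ℝ} (hφ : ContDiff ℝ ∞ φ) (r : Fin (k + 1)) (t : Fin (r : ℕ) → Fin n) :
    ContDiff ℝ ∞ fun x => dLdu n k L r t (jetEv n k φ x) := by
  refine contDiff_const.mul (ContDiff.sum fun σ _ => ?_)
  exact ((hL.fderiv_right (m := ∞) (by simp)).comp (contDiff_jetEv hφ)).clm_apply contDiff_const

lemma dLdu_comp_perm {n k : ℕ} (L : Jet n k → ℝ) (r : Fin (k + 1))
    (τ : Equiv.Perm (Fin (r : ℕ))) (t : Fin (r : ℕ) → Fin n) (z : Jet n k) :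
    dLdu n k L r (t ∘ τ) z = dLdu n k L r t z :=
  tensorSymm_comp_perm (fun t => fderiv ℝ L z (0, Pi.single r (Pi.single t 1))) τ t

lemma symComb_eq_tensorSymm (n l : ℕ) (q : (Fin l → Fin n) → Fin n → ℝ)
    (s : Fin (l + 1) → Fin n) :
    symComb n l q s = tensorSymm (fun t => q (Fin.init t) (t (Fin.last l))) s := rfl

lemma tensorSymm_smoothFn_apply {n l : ℕ} (T : (Fin l → Fin n) → smoothFn n)
    (s : Fin l → Fin n) (x : Vec n) :
    ((tensorSymm T s : smoothFn n) : Vec n → ℝ) x = tensorSymm (fun t => (T t : Vec n → ℝ) x) s := by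
  simp [tensorSymm, Finset.sum_apply]

lemma tensorDiv_smoothPderiv_apply {n l : ℕ} (T : (Fin (l + 1) → Fin n) → smoothFn n)
    (s : Fin l → Fin n) (x : Vec n) :
    ((tensorDiv (smoothPderiv n) T s : smoothFn n) : Vec n → ℝ) x =
      ∑ i, pderiv1 n i (T (Fin.snoc s i)) x := by
  simp [tensorDiv, Finset.sum_apply, smoothPderiv]

/-- the non-symmetric part of the momenta is pure gauge.
If a smooth `φ` together with smooth momenta `p^{μ₁…μ_l λ}` (symmetric in
`μ₁…μ_l`) satisfies the canonical first-order Euler–Lagrange system of a smooth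
`k`-th order Lagrangian `L` (`k = K+1`), then there exist smooth momenta `s`
which are totally symmetric in all their indices and such that `(φ, s)` also
satisfies the canonical first-order Euler–Lagrange system of `L`. -/
theorem statement_11 (n K : ℕ) (hn : 1 ≤ n)
    (L : Jet n (K + 1) → ℝ) (hL : IsCInf L)
    (φ : Vec n → ℝ) (hφ : IsCInf φ)
    (p : Mom n (K + 1)) (hp : MomSmooth n (K + 1) p)
    (hpsym : MomSym n (K + 1) p)
    (hsol : CanonSys n K L φ p) :
    ∃ s : Mom n (K + 1),
      MomSmooth n (K + 1) s ∧ MomTotSym n (K + 1) s ∧ CanonSys n K L φ s := by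
  have hp' : ∀ l t lam, ContDiff ℝ ∞ (p l t lam) := fun l t lam => contDiff_infty.2 (hp l t lam)
  let F : ∀ l : ℕ, (Fin l → Fin n) → smoothFn n := fun l t =>
    if h : l < K + 2 then
      (⟨fun x => dLdu n (K + 1) L ⟨l, h⟩ t (jetEv n (K + 1) φ x),
        show ContDiff ℝ ∞ _ from contDiff_dLdu_jetEv (contDiff_infty.2 hL) (contDiff_infty.2 hφ) ⟨l, h⟩ t⟩ : smoothFn n)
    else 0
  let q : ∀ l : ℕ, (Fin (l + 1) → Fin n) → smoothFn n := fun l t =>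
    if h : l < K + 1 then
      (⟨p ⟨l, h⟩ (Fin.init t) (t (Fin.last l)), show ContDiff ℝ ∞ _ from hp' _ _ _⟩ : smoothFn n)
    else 0
  have hFapp : ∀ (l : ℕ) (h : l < K + 2) (t : Fin l → Fin n) (x : Vec n),
      (F l t : Vec n → ℝ) x = dLdu n (K + 1) L ⟨l, h⟩ t (jetEv n (K + 1) φ x) :=
    fun l h t x => by simp only [F, dif_pos h]
  have hqapp : ∀ (l : ℕ) (h : l < K + 1) (t : Fin (l + 1) → Fin n),
      (q l t : Vec n → ℝ) = p ⟨l, h⟩ (Fin.init t) (t (Fin.last l)) :=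
    fun l h t => by simp only [q, dif_pos h]
  have hFsym : ∀ l (τ : Equiv.Perm (Fin l)) s, F l (s ∘ τ) = F l s := fun l τ s => by
    by_cases h : l < K + 2
    · ext x
      rw [hFapp l h, hFapp l h]
      exact dLdu_comp_perm L ⟨l, h⟩ τ s _
    · simp [F, h]
  have hqtop : ∀ l, K + 1 ≤ l → q l = 0 := fun l hl => by
    funext t
    exact dif_neg (Nat.not_lt.2 hl)
  obtain ⟨G, hGsym, hGtop, hG0, hGrec⟩ := exists_symmetric_tower (commute_smoothPderiv n) (K + 1)
    F q hFsym hqtop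
    (fun s => by
      ext x
      rw [Subsingleton.elim s Fin.elim0, tensorDiv_smoothPderiv_apply, hFapp 0 (by omega)]
      simp only [hqapp 0 K.succ_pos, Fin.init_snoc, Fin.snoc_last]
      exact sub_eq_zero.1 (hsol.1 x))
    (fun l hl s => by
      ext x
      have h := hsol.2 ⟨l, hl⟩ s x
      rw [symComb_eq_tensorSymm] at h
      rw [Submodule.coe_sub, Pi.sub_apply, tensorSymm_smoothFn_apply,
        tensorDiv_smoothPderiv_apply, hFapp (l + 1) (by omega)]
      simp only [hqapp l hl]
      refine h.trans ?_
      congr 1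
      split_ifs with h'
      · simp only [hqapp (l + 1) h', Fin.init_snoc, Fin.snoc_last]
      · simp [hqtop (l + 1) (Nat.not_lt.1 h'), pderiv1])
  refine ⟨fun l t lam => G (l + 1) (Fin.snoc t lam), fun l t lam => contDiff_infty.1 (smoothFn.contDiff _),
    fun l σ s x => ?_, fun x => ?_, fun l s x => ?_⟩
  · have hsnoc : ∀ r : Fin ((l : ℕ) + 1) → Fin n,
        Fin.snoc (α := fun _ => Fin n) (fun i => r (Fin.castSucc i)) (r (Fin.last l)) = r :=
      Fin.snoc_init_self
    change (G (l + 1) (Fin.snoc _ _) : Vec n → ℝ) x = (G (l + 1) (Fin.snoc _ _) : Vec n → ℝ) x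
    rw [hsnoc s, ← hGsym (l + 1) σ s, ← hsnoc (s ∘ σ)]
    rfl
  · have h := congrArg (fun f : smoothFn n => (f : Vec n → ℝ) x)
      (hGrec 0 (Nat.zero_le _) Fin.elim0)
    simp only [hG0, Submodule.coe_sub, Pi.sub_apply, tensorDiv_smoothPderiv_apply,
      hFapp 0 (Nat.succ_pos _)] at h
    exact h.symm
  · have h := congrArg (fun f : smoothFn n => (f : Vec n → ℝ) x) (hGrec (l + 1) l.2 s)
    simp only [Submodule.coe_sub, Pi.sub_apply, tensorDiv_smoothPderiv_apply,
      hFapp (l + 1) (Nat.succ_lt_succ l.2)] at h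
    rw [symComb_eq_tensorSymm]
    simp only [Fin.snoc_init_self]
    rw [tensorSymm_eq_self fun τ s => by rw [hGsym], h]
    congr 1
    split_ifs with h'
    · rfl
    · simp [hGtop (l + 1 + 1) (by omega), pderiv1]
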